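/- For each fixed λ ∈ [0,1], the function (R,Δ) ↦ G^{(λ)}(R,Δ|P) is jointly convex on [0,∞)×[0,∞): for all R₀,R₁,Δ₀,Δ₁ ≥ 0 and all α ∈ [0,1], G^{(λ)}(αR₁+(1−α)R₀, αΔ₁+(1−α)Δ₀ | P) ≤ α·G^{(λ)}(R₁,Δ₁|P) + (1−α)·G^{(λ)}(R₀,Δ₀|P). -/

import Mathlib

open Real Filter

noncomputable section

def IsDist {X : Type*} [Fintype X] (P : X → ℝ) : Prop :=
  (∀ x, 0 ≤ P x) ∧ ∑ x, P x = 1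

def IsJoint {X Y : Type*} [Fintype X] [Fintype Y] (q : X → Y → ℝ) : Prop :=
  (∀ x y, 0 ≤ q x y) ∧ ∑ x, ∑ y, q x y = 1

def IsCond {X Y : Type*} [Fintype X] [Fintype Y] (V : X → Y → ℝ) : Prop :=
  (∀ x y, 0 ≤ V x y) ∧ ∀ x, ∑ y, V x y = 1

def margX {X Y : Type*} [Fintype Y] (q : X → Y → ℝ) (x : X) : ℝ := ∑ y, q x y

def margY {X Y : Type*} [Fintype X] (q : X → Y → ℝ) (y : Y) : ℝ := ∑ x, q x y

/-- conditional distribution of `X` given `Y` : `q_{X|Y}(x|y)` -/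
def condXY {X Y : Type*} [Fintype X] (q : X → Y → ℝ) (x : X) (y : Y) : ℝ :=
  q x y / margY q y

/-- conditional distribution of `Y` given `X` : `q_{Y|X}(y|x)` -/
def condYX {X Y : Type*} [Fintype Y] (q : X → Y → ℝ) (x : X) (y : Y) : ℝ :=
  q x y / margX q x

/-- mutual information `I(q_X, q_{Y|X})` of a joint distribution `q` -/
def mutInfo {X Y : Type*} [Fintype X] [Fintype Y] (q : X → Y → ℝ) : ℝ :=
  ∑ x, ∑ y, q x y * Real.log (q x y / (margX q x * margY q y))

/-- divergence `D(q_X ‖ P)` -/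
def klX {X Y : Type*} [Fintype X] [Fintype Y] (q : X → Y → ℝ) (P : X → ℝ) : ℝ :=
  ∑ x, margX q x * Real.log (margX q x / P x)

/-- divergence `D(p ‖ q)` of distributions on `X` -/
def klD {X : Type*} [Fintype X] (p q : X → ℝ) : ℝ :=
  ∑ x, p x * Real.log (p x / q x)

/-- divergence `D(q ‖ p)` of joint distributions -/
def klJoint {X Y : Type*} [Fintype X] [Fintype Y] (q p : X → Y → ℝ) : ℝ :=
  ∑ x, ∑ y, q x y * Real.log (q x y / p x y)

/-- expected distortion `E_q[d(X,Y)]` -/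
def Ed {X Y : Type*} [Fintype X] [Fintype Y] (q d : X → Y → ℝ) : ℝ :=
  ∑ x, ∑ y, q x y * d x y

/-- `G(R,Δ|P)` -/
def G {X Y : Type*} [Fintype X] [Fintype Y] (P : X → ℝ) (d : X → Y → ℝ) (R Δ : ℝ) : ℝ :=
  sInf {v : ℝ | ∃ q : X → Y → ℝ, IsJoint q ∧ Ed q d ≤ Δ ∧
    v = max 0 (mutInfo q - R) + klX q P}

/-- `G^{(λ)}(R,Δ|P)` -/
def Glam {X Y : Type*} [Fintype X] [Fintype Y] (P : X → ℝ) (d : X → Y → ℝ)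
    (lam R Δ : ℝ) : ℝ :=
  sInf {v : ℝ | ∃ q : X → Y → ℝ, IsJoint q ∧ Ed q d ≤ Δ ∧
    v = lam * (mutInfo q - R) + klX q P}

/-- rate distortion function `R(Δ|P)` -/
def RD {X Y : Type*} [Fintype X] [Fintype Y] (P : X → ℝ) (d : X → Y → ℝ) (Δ : ℝ) : ℝ :=
  sInf {v : ℝ | ∃ V : X → Y → ℝ, IsCond V ∧ Ed (fun x y => P x * V x y) d ≤ Δ ∧
    v = mutInfo (fun x y => P x * V x y)}

/-- `Ω^{(μ,λ)}(P)` -/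
def OmegaF {X Y : Type*} [Fintype X] [Fintype Y] (P : X → ℝ) (d : X → Y → ℝ)
    (μ lam : ℝ) : ℝ :=
  sInf {v : ℝ | ∃ q : X → Y → ℝ, IsJoint q ∧
    v = lam * mutInfo q + klX q P + μ * Ed q d}

/-- `G^{(μ,λ)}(R,Δ|P) = Ω^{(μ,λ)}(P) − λR − μΔ` -/
def Gmulam {X Y : Type*} [Fintype X] [Fintype Y] (P : X → ℝ) (d : X → Y → ℝ)
    (μ lam R Δ : ℝ) : ℝ :=
  OmegaF P d μ lam - lam * R - μ * Δ

/-- `ω_q^{(μ,λ)}(x,y)` -/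
def omg {X Y : Type*} [Fintype X] [Fintype Y] (P : X → ℝ) (d : X → Y → ℝ)
    (μ lam : ℝ) (q : X → Y → ℝ) (x : X) (y : Y) : ℝ :=
  Real.log (margX q x ^ (1 - lam) * condXY q x y ^ lam * Real.exp (μ * d x y) / P x)

/-- `F^{(μ,λ)}(p,q) = E_q[ω_p^{(μ,λ)}(X,Y)] + D(q‖p)` -/
def Ffun {X Y : Type*} [Fintype X] [Fintype Y] (P : X → ℝ) (d : X → Y → ℝ)
    (μ lam : ℝ) (p q : X → Y → ℝ) : ℝ :=
  (∑ x, ∑ y, q x y * omg P d μ lam p x y) + klJoint q p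

/-- `Λ_p^{(μ,λ)} = E_p[exp(−ω_p^{(μ,λ)}(X,Y))]` -/
def Lam {X Y : Type*} [Fintype X] [Fintype Y] (P : X → ℝ) (d : X → Y → ℝ)
    (μ lam : ℝ) (p : X → Y → ℝ) : ℝ :=
  ∑ x, ∑ y, p x y * Real.exp (-(omg P d μ lam p x y))

/-- cutoff rate `R_cut^{(λ)}(Δ|P)` -/
def Rcut {X Y : Type*} [Fintype X] [Fintype Y] (P : X → ℝ) (d : X → Y → ℝ)
    (lam Δ : ℝ) : ℝ :=
  sInf {v : ℝ | ∃ q : X → Y → ℝ, IsJoint q ∧ Ed q d ≤ Δ ∧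
    v = mutInfo q + (1 / lam) * klX q P}

/-- Shannon entropy -/
def entropy {X : Type*} [Fintype X] (p : X → ℝ) : ℝ :=
  -∑ x, p x * Real.log (p x)

/-- The tangent lower bound of `(a, b) ↦ a log (a / b)` along the ray `a / b = c`. -/
lemma sub_mul_le_mul_log_div {a b c : ℝ} (ha : 0 ≤ a) (hb : 0 ≤ b) (hab : b = 0 → a = 0)
    (hc : 0 < c) : a * Real.log c + a - b * c ≤ a * Real.log (a / b) := by
  rcases ha.eq_or_lt with rfl | ha
  · have := mul_nonneg hb hc.le
    simpa using this
  have hb : 0 < b := hb.lt_of_ne fun h => ha.ne' (hab h.symm)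
  have h := Real.one_sub_inv_le_log_of_pos (show 0 < a / b / c by positivity)
  rw [Real.log_div (by positivity) hc.ne'] at h
  have h' := mul_le_mul_of_nonneg_left h ha.le
  have e : a * (1 - (a / b / c)⁻¹) = a - b * c := by field_simp
  linarith

/-- Joint convexity of `(a, b) ↦ a log (a / b)`. -/
lemma mul_log_div_convex {a₀ a₁ b₀ b₁ α : ℝ} (ha₀ : 0 ≤ a₀) (ha₁ : 0 ≤ a₁)
    (hb₀ : 0 ≤ b₀) (hb₁ : 0 ≤ b₁) (h₀ : b₀ = 0 → a₀ = 0) (h₁ : b₁ = 0 → a₁ = 0)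
    (hα₀ : 0 ≤ α) (hα₁ : α ≤ 1) :
    (α * a₁ + (1 - α) * a₀) *
        Real.log ((α * a₁ + (1 - α) * a₀) / (α * b₁ + (1 - α) * b₀)) ≤
      α * (a₁ * Real.log (a₁ / b₁)) + (1 - α) * (a₀ * Real.log (a₀ / b₀)) := by
  have hβ : 0 ≤ 1 - α := sub_nonneg.2 hα₁
  rcases (add_nonneg (mul_nonneg hα₀ ha₁) (mul_nonneg hβ ha₀)).eq_or_lt with h | ha
  · have e₁ : α * a₁ = 0 := by linarith [mul_nonneg hα₀ ha₁, mul_nonneg hβ ha₀]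
    have e₀ : (1 - α) * a₀ = 0 := by linarith [mul_nonneg hα₀ ha₁, mul_nonneg hβ ha₀]
    simp [← mul_assoc, e₁, e₀]
  have hb : 0 < α * b₁ + (1 - α) * b₀ := by
    refine (add_nonneg (mul_nonneg hα₀ hb₁) (mul_nonneg hβ hb₀)).lt_of_ne fun h => ha.ne' ?_
    have e₁ : α * b₁ = 0 := by linarith [mul_nonneg hα₀ hb₁, mul_nonneg hβ hb₀]
    have e₀ : (1 - α) * b₀ = 0 := by linarith [mul_nonneg hα₀ hb₁, mul_nonneg hβ hb₀]
    have e₁' : α * a₁ = 0 := by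
      rcases mul_eq_zero.1 e₁ with h | h <;> simp [h, h₁]
    have e₀' : (1 - α) * a₀ = 0 := by
      rcases mul_eq_zero.1 e₀ with h | h <;> simp [h, h₀]
    rw [e₁', e₀', add_zero]
  have hc := div_pos ha hb
  have t₁ := mul_le_mul_of_nonneg_left (sub_mul_le_mul_log_div ha₁ hb₁ h₁ hc) hα₀
  have t₀ := mul_le_mul_of_nonneg_left (sub_mul_le_mul_log_div ha₀ hb₀ h₀ hc) hβ
  have e := mul_div_cancel₀ (α * a₁ + (1 - α) * a₀) hb.ne'
  linear_combination t₁ + t₀ + e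

lemma margX_mix {X Y : Type*} [Fintype Y] {q₀ q₁ : X → Y → ℝ}
    (α β : ℝ) (x : X) :
    margX (fun x y => α * q₁ x y + β * q₀ x y) x = α * margX q₁ x + β * margX q₀ x := by
  simp [margX, Finset.sum_add_distrib, Finset.mul_sum]

lemma margY_mix {X Y : Type*} [Fintype X] {q₀ q₁ : X → Y → ℝ}
    (α β : ℝ) (y : Y) :
    margY (fun x y => α * q₁ x y + β * q₀ x y) y = α * margY q₁ y + β * margY q₀ y := by
  simp [margY, Finset.sum_add_distrib, Finset.mul_sum]

section Joint

variable {X Y : Type*} [Fintype X] [Fintype Y] {q q₀ q₁ : X → Y → ℝ}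

lemma IsJoint.margX_nonneg (h : IsJoint q) (x : X) : 0 ≤ margX q x :=
  Finset.sum_nonneg fun y _ => h.1 x y

lemma IsJoint.margY_nonneg (h : IsJoint q) (y : Y) : 0 ≤ margY q y :=
  Finset.sum_nonneg fun x _ => h.1 x y

lemma IsJoint.eq_zero_of_margX (h : IsJoint q) {x : X} (hx : margX q x = 0) (y : Y) :
    q x y = 0 :=
  (Finset.sum_eq_zero_iff_of_nonneg fun y _ => h.1 x y).1 hx y (Finset.mem_univ y)

lemma IsJoint.eq_zero_of_margY (h : IsJoint q) {y : Y} (hy : margY q y = 0) (x : X) :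
    q x y = 0 :=
  (Finset.sum_eq_zero_iff_of_nonneg fun x _ => h.1 x y).1 hy x (Finset.mem_univ x)

lemma IsJoint.sum_margX (h : IsJoint q) : ∑ x, margX q x = 1 := h.2

lemma IsJoint.sum_margY (h : IsJoint q) : ∑ y, margY q y = 1 := by
  simp only [margY]
  rw [Finset.sum_comm]
  exact h.2

lemma IsJoint.mutInfo_nonneg (h : IsJoint q) : 0 ≤ mutInfo q := by
  have key : ∀ x y, q x y - margX q x * margY q y ≤
      q x y * Real.log (q x y / (margX q x * margY q y)) := fun x y => by
    have := sub_mul_le_mul_log_div (h.1 x y)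
      (mul_nonneg (h.margX_nonneg x) (h.margY_nonneg y))
      (fun h0 => (mul_eq_zero.1 h0).elim (fun hx => h.eq_zero_of_margX hx y)
        (fun hy => h.eq_zero_of_margY hy x)) one_pos
    simpa using this
  calc (0 : ℝ) = ∑ x, ∑ y, (q x y - margX q x * margY q y) := by
        simp [Finset.sum_sub_distrib, ← Finset.mul_sum, h.2, h.sum_margY, h.sum_margX]
    _ ≤ mutInfo q := Finset.sum_le_sum fun x _ => Finset.sum_le_sum fun y _ => key x y

lemma IsJoint.klX_nonneg (h : IsJoint q) {P : X → ℝ} (hP : IsDist P) (hPpos : ∀ x, 0 < P x) :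
    0 ≤ klX q P :=
  calc (0 : ℝ) = ∑ x, (margX q x - P x) := by
        simp [Finset.sum_sub_distrib, hP.2, h.sum_margX]
    _ ≤ klX q P := Finset.sum_le_sum fun x _ => by
        simpa using sub_mul_le_mul_log_div (h.margX_nonneg x) (hPpos x).le
          (fun h0 => absurd h0 (hPpos x).ne') one_pos

lemma IsJoint.mutInfo_add_klX (h : IsJoint q) {P : X → ℝ} (hPpos : ∀ x, 0 < P x) :
    mutInfo q + klX q P =
      ∑ x, ∑ y, q x y * Real.log (q x y / margY q y) - ∑ x, margX q x * Real.log (P x) := by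
  simp only [mutInfo, klX]
  rw [← Finset.sum_add_distrib, ← Finset.sum_sub_distrib]
  refine Finset.sum_congr rfl fun x _ => ?_
  nth_rewrite 2 [margX]
  nth_rewrite 3 [margX]
  rw [Finset.sum_mul, Finset.sum_mul, ← Finset.sum_add_distrib, ← Finset.sum_sub_distrib]
  refine Finset.sum_congr rfl fun y _ => ?_
  rcases eq_or_ne (q x y) 0 with h0 | h0
  · simp [h0]
  have hx : margX q x ≠ 0 := fun hx => h0 (h.eq_zero_of_margX hx y)
  have hy : margY q y ≠ 0 := fun hy => h0 (h.eq_zero_of_margY hy x)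
  rw [Real.log_div h0 (mul_ne_zero hx hy), Real.log_mul hx hy, Real.log_div hx (hPpos x).ne',
    Real.log_div h0 hy]
  ring

lemma Ed_mix (d : X → Y → ℝ) (α β : ℝ) :
    Ed (fun x y => α * q₁ x y + β * q₀ x y) d = α * Ed q₁ d + β * Ed q₀ d := by
  simp [Ed, add_mul, Finset.sum_add_distrib, Finset.mul_sum, mul_assoc]

lemma IsJoint.mix (h₁ : IsJoint q₁) (h₀ : IsJoint q₀) {α : ℝ} (hα₀ : 0 ≤ α) (hα₁ : α ≤ 1) :
    IsJoint (fun x y => α * q₁ x y + (1 - α) * q₀ x y) := by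
  refine ⟨fun x y => add_nonneg (mul_nonneg hα₀ (h₁.1 x y))
    (mul_nonneg (sub_nonneg.2 hα₁) (h₀.1 x y)), ?_⟩
  simp [Finset.sum_add_distrib, ← Finset.mul_sum, h₁.2, h₀.2]

lemma klX_mix_le (h₁ : IsJoint q₁) (h₀ : IsJoint q₀) {P : X → ℝ} (hPpos : ∀ x, 0 < P x)
    {α : ℝ} (hα₀ : 0 ≤ α) (hα₁ : α ≤ 1) :
    klX (fun x y => α * q₁ x y + (1 - α) * q₀ x y) P ≤
      α * klX q₁ P + (1 - α) * klX q₀ P := by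
  simp only [klX, margX_mix]
  rw [Finset.mul_sum, Finset.mul_sum, ← Finset.sum_add_distrib]
  refine Finset.sum_le_sum fun x _ => ?_
  have hx : P x = 0 → ∀ a : ℝ, a = 0 := fun h => absurd h (hPpos x).ne'
  have := mul_log_div_convex (h₀.margX_nonneg x) (h₁.margX_nonneg x) (hPpos x).le (hPpos x).le
    (fun h => hx h _) (fun h => hx h _) hα₀ hα₁
  rwa [show α * P x + (1 - α) * P x = P x by ring] at this

lemma mutInfo_add_klX_mix_le (h₁ : IsJoint q₁) (h₀ : IsJoint q₀) {P : X → ℝ}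
    (hPpos : ∀ x, 0 < P x) {α : ℝ} (hα₀ : 0 ≤ α) (hα₁ : α ≤ 1) :
    mutInfo (fun x y => α * q₁ x y + (1 - α) * q₀ x y) +
        klX (fun x y => α * q₁ x y + (1 - α) * q₀ x y) P ≤
      α * (mutInfo q₁ + klX q₁ P) + (1 - α) * (mutInfo q₀ + klX q₀ P) := by
  rw [(h₁.mix h₀ hα₀ hα₁).mutInfo_add_klX hPpos, h₁.mutInfo_add_klX hPpos,
    h₀.mutInfo_add_klX hPpos]
  have hlog : ∑ x, ∑ y, (α * q₁ x y + (1 - α) * q₀ x y) *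
        Real.log ((α * q₁ x y + (1 - α) * q₀ x y) / (α * margY q₁ y + (1 - α) * margY q₀ y)) ≤
      α * ∑ x, ∑ y, q₁ x y * Real.log (q₁ x y / margY q₁ y) +
        (1 - α) * ∑ x, ∑ y, q₀ x y * Real.log (q₀ x y / margY q₀ y) := by
    simp only [Finset.mul_sum]
    rw [← Finset.sum_add_distrib]
    refine Finset.sum_le_sum fun x _ => ?_
    rw [← Finset.sum_add_distrib]
    exact Finset.sum_le_sum fun y _ => mul_log_div_convex (h₀.1 x y) (h₁.1 x y)
      (h₀.margY_nonneg y) (h₁.margY_nonneg y) (fun h => h₀.eq_zero_of_margY h x)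
      (fun h => h₁.eq_zero_of_margY h x) hα₀ hα₁
  have hlin : ∑ x, (α * margX q₁ x + (1 - α) * margX q₀ x) * Real.log (P x) =
      α * ∑ x, margX q₁ x * Real.log (P x) + (1 - α) * ∑ x, margX q₀ x * Real.log (P x) := by
    simp only [Finset.mul_sum, ← Finset.sum_add_distrib]
    exact Finset.sum_congr rfl fun x _ => by ring
  simp only [margX_mix, margY_mix, hlin]
  linear_combination hlog

open Classical in
lemma exists_isJoint_Ed_eq_zero {P : X → ℝ} (hP : IsDist P) {d : X → Y → ℝ}
    (hd0 : ∀ x, ∃ y, d x y = 0) : ∃ q : X → Y → ℝ, IsJoint q ∧ Ed q d = 0 := by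
  choose f hf using hd0
  refine ⟨fun x y => if y = f x then P x else 0, ⟨fun x y => ?_, ?_⟩, ?_⟩
  · dsimp only
    split_ifs
    exacts [hP.1 x, le_rfl]
  · simpa using hP.2
  · simp [Ed, hf]

end Joint

/-- for each fixed `λ ∈ [0,1]`, `(R,Δ) ↦ G^{(λ)}(R,Δ|P)` is
jointly convex on `[0,∞)×[0,∞)`. -/
theorem stmt6 {X Y : Type*} [Fintype X] [Fintype Y]
    (P : X → ℝ) (hP : IsDist P) (hPpos : ∀ x, 0 < P x)
    (d : X → Y → ℝ) (hd : ∀ x y, 0 ≤ d x y) (hd0 : ∀ x, ∃ y, d x y = 0) :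
    ∀ lam : ℝ, 0 ≤ lam → lam ≤ 1 →
      ∀ R₀ R₁ Δ₀ Δ₁ α : ℝ, 0 ≤ R₀ → 0 ≤ R₁ → 0 ≤ Δ₀ → 0 ≤ Δ₁ →
        0 ≤ α → α ≤ 1 →
        Glam P d lam (α * R₁ + (1 - α) * R₀) (α * Δ₁ + (1 - α) * Δ₀) ≤
          α * Glam P d lam R₁ Δ₁ + (1 - α) * Glam P d lam R₀ Δ₀ := by
  intro lam hl0 hl1 R₀ R₁ Δ₀ Δ₁ α hR₀ hR₁ hΔ₀ hΔ₁ hα₀ hα₁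
  have hβ : 0 ≤ 1 - α := sub_nonneg.2 hα₁
  have hne : ∀ R Δ : ℝ, 0 ≤ Δ → {v : ℝ | ∃ q : X → Y → ℝ, IsJoint q ∧ Ed q d ≤ Δ ∧
      v = lam * (mutInfo q - R) + klX q P}.Nonempty := fun R Δ hΔ => by
    obtain ⟨q, hq, hE⟩ := exists_isJoint_Ed_eq_zero hP hd0
    exact ⟨_, q, hq, hE.trans_le hΔ, rfl⟩
  have hbdd : ∀ R Δ : ℝ, BddBelow {v : ℝ | ∃ q : X → Y → ℝ, IsJoint q ∧ Ed q d ≤ Δ ∧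
      v = lam * (mutInfo q - R) + klX q P} := fun R Δ => by
    refine ⟨-(lam * R), ?_⟩
    rintro v ⟨q, hq, -, rfl⟩
    linear_combination mul_nonneg hl0 hq.mutInfo_nonneg + hq.klX_nonneg hP hPpos
  refine le_of_forall_pos_le_add fun ε hε => ?_
  obtain ⟨_, ⟨q₁, hq₁, hE₁, rfl⟩, hv₁⟩ := Real.lt_sInf_add_pos (hne R₁ Δ₁ hΔ₁) hε
  obtain ⟨_, ⟨q₀, hq₀, hE₀, rfl⟩, hv₀⟩ := Real.lt_sInf_add_pos (hne R₀ Δ₀ hΔ₀) hε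
  refine (csInf_le (hbdd _ _) ⟨_, hq₁.mix hq₀ hα₀ hα₁, ?_, rfl⟩).trans ?_
  · rw [Ed_mix]
    exact add_le_add (mul_le_mul_of_nonneg_left hE₁ hα₀) (mul_le_mul_of_nonneg_left hE₀ hβ)
  have k := mul_le_mul_of_nonneg_left (klX_mix_le hq₁ hq₀ hPpos hα₀ hα₁) (sub_nonneg.2 hl1)
  have m := mul_le_mul_of_nonneg_left (mutInfo_add_klX_mix_le hq₁ hq₀ hPpos hα₀ hα₁) hl0
  have w₁ := mul_le_mul_of_nonneg_left hv₁.le hα₀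
  have w₀ := mul_le_mul_of_nonneg_left hv₀.le hβ
  unfold Glam
  linear_combination k + m + w₁ + w₀
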